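/- Let ψ be an admissible obstacle. Then for each ε > 0 the penalized energy E_ε admits a minimizer in P_ψ, i.e. there exists γ ∈ P_ψ with E_ε(γ) = inf_{τ ∈ P_ψ} E_ε(τ). -/

import Mathlib

open MeasureTheory Set Topology Filter

noncomputable section

/-- A function of class `W^{2,2}(0,1)`, identified with its `C¹([0,1])` representative:
`u` has weak derivatives `du`, `ddu` (encoded through the fundamental theorem of calculus)
with `du, ddu ∈ L¹(0,1)` and `ddu ∈ L²(0,1)`. -/
structure W22 where
  u : ℝ → ℝ
  du : ℝ → ℝ
  ddu : ℝ → ℝ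
  du_int : IntegrableOn du (Icc (0:ℝ) 1)
  ddu_int : IntegrableOn ddu (Icc (0:ℝ) 1)
  ddu_sq : IntegrableOn (fun x => (ddu x)^2) (Icc (0:ℝ) 1)
  ftc_u : ∀ x ∈ Icc (0:ℝ) 1, u x = u 0 + ∫ s in (0:ℝ)..x, du s
  ftc_du : ∀ x ∈ Icc (0:ℝ) 1, du x = du 0 + ∫ s in (0:ℝ)..x, ddu s

/-- The elastic energy of a graph. -/
def graphE (f : W22) : ℝ :=
  ∫ x in Ioo (0:ℝ) 1, (f.ddu x)^2 / (1 + (f.du x)^2) ^ ((5:ℝ)/2)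

/-- The length of a graph. -/
def graphLen (f : W22) : ℝ :=
  ∫ x in Ioo (0:ℝ) 1, Real.sqrt (1 + (f.du x)^2)

/-- The length-penalized elastic energy of a graph. -/
def graphPE (ε : ℝ) (f : W22) : ℝ := graphE f + ε * graphLen f

/-- Membership in the admissible class `G_ψ`. -/
def MemG (ψ : ℝ → ℝ) (f : W22) : Prop :=
  f.u 0 = 0 ∧ f.u 1 = 0 ∧ ∀ x ∈ Icc (0:ℝ) 1, ψ x ≤ f.u x

/-- An admissible obstacle. -/
structure Admissible (ψ : ℝ → ℝ) : Prop where
  cont : ContinuousOn ψ (Icc 0 1)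
  neg0 : ψ 0 < 0
  neg1 : ψ 1 < 0
  pos : ∃ x ∈ Icc (0:ℝ) 1, 0 < ψ x
  osd : ∃ C : ℝ, ∀ x ∈ Ioo (0:ℝ) 1,
      (∃ d : ℝ, |d| ≤ C ∧ HasDerivWithinAt ψ d (Ici x) x) ∧
      (∃ d : ℝ, |d| ≤ C ∧ HasDerivWithinAt ψ d (Iic x) x)

/-- `‖ψ'‖_∞`, the smallest uniform bound for the one-sided derivatives of `ψ` on `(0,1)`. -/
def obstNorm (ψ : ℝ → ℝ) : ℝ :=
  sInf {C : ℝ | 0 ≤ C ∧ ∀ x ∈ Ioo (0:ℝ) 1, ∀ d : ℝ,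
    (HasDerivWithinAt ψ d (Ici x) x ∨ HasDerivWithinAt ψ d (Iic x) x) → |d| ≤ C}

/-- A planar curve on `(0,1)` of class `W^{1,1}((0,1);ℝ²)`. -/
structure Curve1 where
  x : ℝ → ℝ
  y : ℝ → ℝ
  dx : ℝ → ℝ
  dy : ℝ → ℝ
  dx_int : IntegrableOn dx (Icc (0:ℝ) 1)
  dy_int : IntegrableOn dy (Icc (0:ℝ) 1)
  ftc_x : ∀ t ∈ Icc (0:ℝ) 1, x t = x 0 + ∫ s in (0:ℝ)..t, dx s
  ftc_y : ∀ t ∈ Icc (0:ℝ) 1, y t = y 0 + ∫ s in (0:ℝ)..t, dy s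

/-- A planar curve of class `W^{1,1}((0,1);ℝ²) ∩ W^{2,1}_loc((0,1);ℝ²)`. -/
structure Curve extends Curve1 where
  ddx : ℝ → ℝ
  ddy : ℝ → ℝ
  ddx_loc : ∀ a b : ℝ, 0 < a → b < 1 → IntegrableOn ddx (Icc a b)
  ddy_loc : ∀ a b : ℝ, 0 < a → b < 1 → IntegrableOn ddy (Icc a b)
  ftc_dx : ∀ a ∈ Ioo (0:ℝ) 1, ∀ t ∈ Ioo (0:ℝ) 1, dx t = dx a + ∫ s in a..t, ddx s
  ftc_dy : ∀ a ∈ Ioo (0:ℝ) 1, ∀ t ∈ Ioo (0:ℝ) 1, dy t = dy a + ∫ s in a..t, ddy s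

/-- `|γ'(t)|`. -/
def speed1 (γ : Curve1) (t : ℝ) : ℝ := Real.sqrt ((γ.dx t)^2 + (γ.dy t)^2)

/-- The length `L(γ) = ∫₀¹ |γ'| dt`, as an extended real number. -/
def len1E (γ : Curve1) : ENNReal := ∫⁻ t in Ioo (0:ℝ) 1, ENNReal.ofReal (speed1 γ t)

/-- The length `L(γ)`, as a real number. -/
def len1 (γ : Curve1) : ℝ := ∫ t in Ioo (0:ℝ) 1, speed1 γ t

def lenE (γ : Curve) : ENNReal := len1E γ.toCurve1

/-- The integrand `⟨γ'', N_γ⟩²/|γ'|³` of the elastic energy. -/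
def elInt (γ : Curve) (t : ℝ) : ℝ :=
  (γ.dx t * γ.ddy t - γ.dy t * γ.ddx t)^2 / ((γ.dx t)^2 + (γ.dy t)^2) ^ ((5:ℝ)/2)

/-- Elastic energy of a curve, as an extended real number. -/
def elE (γ : Curve) : ENNReal := ∫⁻ t in Ioo (0:ℝ) 1, ENNReal.ofReal (elInt γ t)

/-- The length-penalized elastic energy `E_ε = E + ε·L`. -/
def penE (ε : ℝ) (γ : Curve) : ENNReal := elE γ + ENNReal.ofReal ε * lenE γ

/-- A curve is immersed if `|γ'| > ε` on `(0,1)` for some `ε > 0`. -/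
def Curve.Immersed (γ : Curve) : Prop :=
  ∃ ε > 0, ∀ t ∈ Ioo (0:ℝ) 1, ε < speed1 γ.toCurve1 t

/-- `u` lies in `W^{2,2}_loc(c,d)` with weak derivatives `du`, `ddu`. -/
structure W22locOn (u du ddu : ℝ → ℝ) (c d : ℝ) : Prop where
  du_loc : ∀ a b : ℝ, c < a → b < d → IntegrableOn du (Icc a b)
  ddu_loc : ∀ a b : ℝ, c < a → b < d → IntegrableOn ddu (Icc a b)
  ddu_sq : ∀ a b : ℝ, c < a → b < d → IntegrableOn (fun t => (ddu t)^2) (Icc a b)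
  ftc_u : ∀ a ∈ Ioo c d, ∀ t ∈ Ioo c d, u t = u a + ∫ s in a..t, du s
  ftc_du : ∀ a ∈ Ioo c d, ∀ t ∈ Ioo c d, du t = du a + ∫ s in a..t, ddu s

/-- `γ` is a pseudograph. -/
def Pseudograph (γ : Curve) : Prop :=
  γ.Immersed ∧ (∀ t ∈ Ioo (0:ℝ) 1, 0 ≤ γ.dx t) ∧
  ∀ a b : ℝ, 0 ≤ a → a < b → b ≤ 1 → (∀ t ∈ Ioo a b, 0 < γ.dx t) →
    ∃ u du ddu : ℝ → ℝ, W22locOn u du ddu (γ.x a) (γ.x b) ∧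
      ∀ t ∈ Ioo a b, u (γ.x t) = γ.y t

/-- Membership in `P_ψ`. -/
def MemP (ψ : ℝ → ℝ) (γ : Curve) : Prop :=
  Pseudograph γ ∧ γ.x 0 = 0 ∧ γ.y 0 = 0 ∧ γ.x 1 = 1 ∧ γ.y 1 = 0 ∧
  ∀ t ∈ Icc (0:ℝ) 1, ψ (γ.x t) ≤ γ.y t

/-- `v : (a,b) → (c,d)` is invertible in `W^{1,1}` (increasing case): it has an
inverse `w` which is again of class `W^{1,1}`. -/
def InvertibleW11On (v : ℝ → ℝ) (a b c d : ℝ) : Prop :=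
  ∃ w dw : ℝ → ℝ, IntegrableOn dw (Icc c d) ∧
    (∀ s ∈ Icc c d, w s = w c + ∫ r in c..s, dw r) ∧
    (∀ t ∈ Ioo a b, v t ∈ Ioo c d ∧ w (v t) = t) ∧
    (∀ s ∈ Ioo c d, w s ∈ Ioo a b ∧ v (w s) = s)

/-- `γ ∈ M_{γ₀}`: a `∩`-shaped curve above `γ₀` with parameters `β₁, β₂` and
graph reparametrization `u`. -/
structure CapAbove (γ : Curve1) (γ₀ : Curve) (β₁ β₂ : ℝ) (u : ℝ → ℝ) : Prop where
  ep0 : γ.x 0 = 0 ∧ γ.y 0 = 0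
  ep1 : γ.x 1 = 1 ∧ γ.y 1 = 0
  hβ : 0 ≤ β₁ ∧ β₁ < β₂ ∧ β₂ ≤ 1
  left : ∀ t ∈ Icc (0:ℝ) β₁, γ.x t = 0
  right : ∀ t ∈ Icc β₂ (1:ℝ), γ.x t = 1
  inv : InvertibleW11On γ.x β₁ β₂ 0 1
  graph : ∀ t ∈ Ioo β₁ β₂, u (γ.x t) = γ.y t
  ucont : ContinuousOn u (Icc (0:ℝ) 1)
  above : ∀ t ∈ Icc (0:ℝ) 1, γ₀.y t ≤ u (γ₀.x t)

/-- A `∩`-shaped pseudograph with parameters `β₁, β₂` and graph reparametrization `u`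
(with weak derivatives `du`, `ddu`). -/
structure CapShaped (γ : Curve) (β₁ β₂ : ℝ) (u du ddu : ℝ → ℝ) : Prop where
  hβ : 0 ≤ β₁ ∧ β₁ < β₂ ∧ β₂ ≤ 1
  left : ∀ t ∈ Icc (0:ℝ) β₁, γ.x t = 0
  right : ∀ t ∈ Icc β₂ (1:ℝ), γ.x t = 1
  pos : ∀ t ∈ Ioo β₁ β₂, 0 < γ.dx t
  graph : ∀ t ∈ Ioo β₁ β₂, u (γ.x t) = γ.y t
  reg : W22locOn u du ddu 0 1

/-- `G(x) = ∫₀ˣ (1+s²)^{-5/4} ds`. -/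
def Gfun (x : ℝ) : ℝ := ∫ s in (0:ℝ)..x, ((1 + s^2) ^ (-(5:ℝ)/4) : ℝ)

/-- `c₀ = ∫_ℝ (1+s²)^{-5/4} ds`. -/
def c0 : ℝ := ∫ s : ℝ, ((1 + s^2) ^ (-(5:ℝ)/4) : ℝ)

/-- The inverse of `G`. -/
def Ginv : ℝ → ℝ := Function.invFun Gfun

/-- The ratio `R(B)` from the nonexistence theorem. -/
def ratio (B : ℝ) : ℝ :=
  (∫ t in (0:ℝ)..B, t / (Real.sqrt (B - t) * (1 + t^2) ^ ((5:ℝ)/4))) /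
  (2 * ∫ t in (0:ℝ)..B, 1 / (Real.sqrt (B - t) * (1 + t^2) ^ ((5:ℝ)/4)))

/-- The symmetric cone obstacle with valley `[0,s]` and peak `A`. -/
def coneObstacle (A s : ℝ) : ℝ → ℝ := fun x =>
  if x ≤ 1/2 then A / (1/2 - s) * (x - s) else A / (1/2 - s) * (1 - s - x)

theorem LipschitzOnWith.comp_absolutelyContinuousOnInterval {f g : ℝ → ℝ} {a b : ℝ} {s : Set ℝ}
    {K : NNReal} (hg : LipschitzOnWith K g s) (hf : AbsolutelyContinuousOnInterval f a b)
    (hs : MapsTo f (uIcc a b) s) : AbsolutelyContinuousOnInterval (fun x => g (f x)) a b := by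
  rw [absolutelyContinuousOnInterval_iff] at hf ⊢
  intro e he
  obtain ⟨δ, hδ, h⟩ := hf (e / (K + 1)) (by positivity)
  refine ⟨δ, hδ, fun E hE hlt => ?_⟩
  have h1 := h E hE hlt
  rw [lt_div_iff₀ (by positivity)] at h1
  have hmem : ∀ i ∈ Finset.range E.1, (E.2 i).1 ∈ uIcc a b ∧ (E.2 i).2 ∈ uIcc a b := hE.1
  calc ∑ i ∈ Finset.range E.1, dist (g (f (E.2 i).1)) (g (f (E.2 i).2))
      ≤ ∑ i ∈ Finset.range E.1, K * dist (f (E.2 i).1) (f (E.2 i).2) :=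
        Finset.sum_le_sum fun i hi => hg.dist_le_mul _ (hs (hmem i hi).1) _ (hs (hmem i hi).2)
    _ = K * ∑ i ∈ Finset.range E.1, dist (f (E.2 i).1) (f (E.2 i).2) := by rw [Finset.mul_sum]
    _ ≤ (∑ i ∈ Finset.range E.1, dist (f (E.2 i).1) (f (E.2 i).2)) * (K + 1) := by
        have : 0 ≤ ∑ i ∈ Finset.range E.1, dist (f (E.2 i).1) (f (E.2 i).2) :=
          Finset.sum_nonneg fun _ _ => dist_nonneg
        nlinarith
    _ < e := h1

/-- `f` is a primitive of the integrable function `f'` on `[a,b]`. -/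
def IsPrim (f f' : ℝ → ℝ) (a b : ℝ) : Prop :=
  AbsolutelyContinuousOnInterval f a b ∧ ∀ᵐ x, x ∈ uIcc a b → HasDerivAt f (f' x) x

theorem isPrim_of_integral {f f' : ℝ → ℝ} {a b : ℝ} (hi : IntervalIntegrable f' volume a b)
    (h : ∀ x ∈ uIcc a b, f x = f a + ∫ s in a..x, f' s) : IsPrim f f' a b := by
  constructor
  · have h1 := hi.absolutelyContinuousOnInterval_intervalIntegral (c := a) left_mem_uIcc
    rw [absolutelyContinuousOnInterval_iff] at h1 ⊢
    intro e he
    obtain ⟨δ, hδ, h2⟩ := h1 e he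
    refine ⟨δ, hδ, fun E hE hlt => ?_⟩
    have hmem : ∀ i ∈ Finset.range E.1, (E.2 i).1 ∈ uIcc a b ∧ (E.2 i).2 ∈ uIcc a b := hE.1
    refine lt_of_eq_of_lt (Finset.sum_congr rfl fun i hi => ?_) (h2 E hE hlt)
    rw [h _ (hmem i hi).1, h _ (hmem i hi).2, dist_add_left]
  · have h₁ : ∀ᵐ x, x ≠ min a b := by simp [ae_iff, measure_singleton]
    have h₂ : ∀ᵐ x, x ≠ max a b := by simp [ae_iff, measure_singleton]
    filter_upwards [hi.ae_hasDerivAt_integral, h₁, h₂] with x hx h1 h2 hm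
    have hd := (hx hm a left_mem_uIcc).const_add (f a)
    refine hd.congr_of_eventuallyEq ?_
    have : uIcc a b ∈ 𝓝 x :=
      Icc_mem_nhds (lt_of_le_of_ne hm.1 h1.symm) (lt_of_le_of_ne hm.2 h2)
    filter_upwards [this] with y hy using h y hy

namespace IsPrim

variable {f f' g g' : ℝ → ℝ} {a b : ℝ}

theorem integral_eq (h : IsPrim f f' a b) : ∫ x in a..b, f' x = f b - f a := by
  rw [← h.1.integral_deriv_eq_sub]
  refine intervalIntegral.integral_congr_ae ?_
  filter_upwards [h.2] with x hx hm
  exact (hx (uIoc_subset_uIcc hm)).deriv.symm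

theorem intervalIntegrable (h : IsPrim f f' a b) : IntervalIntegrable f' volume a b := by
  refine h.1.intervalIntegrable_deriv.congr_ae ?_
  rw [Filter.EventuallyEq, ae_restrict_iff' measurableSet_uIoc]
  filter_upwards [h.2] with x hx hm
  exact (hx (uIoc_subset_uIcc hm)).deriv

theorem mul (hf : IsPrim f f' a b) (hg : IsPrim g g' a b) :
    IsPrim (fun x => f x * g x) (fun x => f' x * g x + f x * g' x) a b := by
  refine ⟨hf.1.fun_mul hg.1, ?_⟩
  filter_upwards [hf.2, hg.2] with x h1 h2 hm
  exact (h1 hm).mul (h2 hm)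

theorem add (hf : IsPrim f f' a b) (hg : IsPrim g g' a b) :
    IsPrim (fun x => f x + g x) (fun x => f' x + g' x) a b := by
  refine ⟨hf.1.fun_add hg.1, ?_⟩
  filter_upwards [hf.2, hg.2] with x h1 h2 hm
  exact (h1 hm).add (h2 hm)

theorem comp {φ φ' : ℝ → ℝ} (hf : IsPrim f f' a b)
    (hpos : ∀ x ∈ uIcc a b, 0 < f x) (hφ : ∀ y, 0 < y → HasDerivAt φ (φ' y) y)
    (hc : ContinuousOn φ' (Ioi 0)) :
    IsPrim (fun x => φ (f x)) (fun x => φ' (f x) * f' x) a b := by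
  constructor
  · obtain ⟨m, hm, hmin⟩ := isCompact_uIcc.exists_isMinOn nonempty_uIcc hf.1.continuousOn
    obtain ⟨M, hM, hmax⟩ := isCompact_uIcc.exists_isMaxOn nonempty_uIcc hf.1.continuousOn
    have hsub : Icc (f m) (f M) ⊆ Ioi 0 := fun y hy => (hpos m hm).trans_le hy.1
    obtain ⟨C, hC⟩ := isCompact_Icc.exists_bound_of_continuousOn (hc.mono hsub)
    have hC0 : 0 ≤ C := (norm_nonneg _).trans (hC (f m) ⟨le_rfl, hmin hM⟩)
    have hl : LipschitzOnWith ⟨C, hC0⟩ φ (Icc (f m) (f M)) :=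
      (convex_Icc _ _).lipschitzOnWith_of_nnnorm_hasDerivWithin_le
        (fun y hy => (hφ y (hsub hy)).hasDerivWithinAt) (fun y hy => hC y hy)
    exact hl.comp_absolutelyContinuousOnInterval hf.1 fun x hx => ⟨hmin hx, hmax hx⟩
  · filter_upwards [hf.2] with x h1 hm
    exact (hφ _ (hpos x hm)).comp x (h1 hm)

end IsPrim

theorem Ultrafilter.exists_tendsto_of_abs_le {ι : Type*} (U : Ultrafilter ι) {f : ι → ℝ} {C : ℝ}
    (h : ∀ n, |f n| ≤ C) : ∃ a, |a| ≤ C ∧ Tendsto f U (𝓝 a) := by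
  have hm : ∀ n, f n ∈ Icc (-C) C := fun n => abs_le.1 (h n)
  obtain ⟨a, ha, hle⟩ := isCompact_Icc.ultrafilter_le_nhds (U.map f)
    (Filter.le_principal_iff.2 (Filter.mem_map.2 (Filter.univ_mem' hm)))
  exact ⟨a, abs_le.2 ha, hle⟩

/-- A bounded sequence in a Hilbert space has a weak limit. -/
theorem exists_weak_limit {H : Type*} [NormedAddCommGroup H] [InnerProductSpace ℝ H]
    [CompleteSpace H] {ι : Type*} (U : Ultrafilter ι) (v : ι → H) (M : ℝ) (hv : ∀ n, ‖v n‖ ≤ M) :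
    ∃ w : H, ∀ φ : H →L[ℝ] ℝ, Tendsto (fun n => φ (v n)) U (𝓝 (φ w)) := by
  have hlim : ∀ φ : H →L[ℝ] ℝ, ∃ a, |a| ≤ ‖φ‖ * M ∧ Tendsto (fun n => φ (v n)) U (𝓝 a) := by
    intro φ
    exact U.exists_tendsto_of_abs_le (fun n =>
      (φ.le_opNorm _).trans (mul_le_mul_of_nonneg_left (hv n) (norm_nonneg _)))
  choose Λ hΛ hT using fun x : H => hlim (innerSL ℝ x)
  let Φ : H →ₗ[ℝ] ℝ :=
    { toFun := Λ
      map_add' := fun x y => tendsto_nhds_unique (hT (x + y)) (by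
        simpa [inner_add_left] using (hT x).add (hT y))
      map_smul' := fun c x => tendsto_nhds_unique (hT (c • x)) (by
        simpa [inner_smul_left] using (hT x).const_mul c) }
  let Ψ : H →L[ℝ] ℝ := Φ.mkContinuous M fun x => by
    simpa [Φ, mul_comm] using hΛ x
  refine ⟨(InnerProductSpace.toDual ℝ H).symm Ψ, fun φ => ?_⟩
  set x := (InnerProductSpace.toDual ℝ H).symm φ with hx
  have h1 : ∀ z, φ z = inner ℝ x z := fun z => by simp [hx]
  have h2 : φ ((InnerProductSpace.toDual ℝ H).symm Ψ) = Λ x := by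
    rw [h1, real_inner_comm]
    simp [Ψ, Φ]
  rw [h2]
  simpa [h1] using hT x

theorem norm_sq_le_of_weak_limit {H : Type*} [NormedAddCommGroup H] [InnerProductSpace ℝ H]
    {ι : Type*} {U : Filter ι} [U.NeBot] {v : ι → H} {w : H} {A : ℝ}
    (hw : ∀ φ : H →L[ℝ] ℝ, Tendsto (fun n => φ (v n)) U (𝓝 (φ w)))
    (hA : Tendsto (fun n => ‖v n‖ ^ 2) U (𝓝 A)) : ‖w‖ ^ 2 ≤ A := by
  have h1 := (hw (innerSL ℝ w)).const_mul 2
  have h2 : Tendsto (fun n => ‖v n‖ ^ 2 - 2 * (inner ℝ w (v n))) U (𝓝 (A - 2 * ‖w‖ ^ 2)) := by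
    simpa using hA.sub h1
  have h3 : -‖w‖ ^ 2 ≤ A - 2 * ‖w‖ ^ 2 := by
    refine ge_of_tendsto' h2 fun n => ?_
    have := norm_sub_sq_real w (v n)
    nlinarith [sq_nonneg ‖w - v n‖]
  linarith

/-- The primitive of `f` taking the value `c` at `0`. -/
def prim (c : ℝ) (f : ℝ → ℝ) (s : ℝ) : ℝ := c + ∫ r in (0:ℝ)..s, f r

/-- The Hilbert space `L²(0,1)`. -/
abbrev L2 := Lp ℝ 2 (volume.restrict (Icc (0:ℝ) 1))

theorem integrableOn_coe (v : L2) : IntegrableOn v (Icc (0:ℝ) 1) :=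
  (Lp.memLp v).integrable (by norm_num)

theorem intervalIntegrable_coe (v : L2) {a b : ℝ} (ha : a ∈ Icc (0:ℝ) 1) (hb : b ∈ Icc (0:ℝ) 1) :
    IntervalIntegrable v volume a b := by
  rw [intervalIntegrable_iff]
  exact (integrableOn_coe v).mono_set (uIoc_subset_uIcc.trans (uIcc_subset_Icc ha hb))

theorem norm_sq_eq_integral (v : L2) : ‖v‖ ^ 2 = ∫ x in Icc (0:ℝ) 1, (v x) ^ 2 := by
  rw [← real_inner_self_eq_norm_sq, L2.inner_def]
  simp [pow_two]

theorem continuousOn_prim {f : ℝ → ℝ} (hf : IntegrableOn f (Icc (0:ℝ) 1)) (c : ℝ) :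
    ContinuousOn (prim c f) (Icc (0:ℝ) 1) := by
  have h := intervalIntegral.continuousOn_primitive_interval (a := (0:ℝ)) (b := 1) (f := f)
    (μ := volume) (by simpa using hf)
  rw [uIcc_of_le zero_le_one] at h
  exact continuousOn_const.add h

theorem prim_sub {f : ℝ → ℝ} (hf : IntegrableOn f (Icc (0:ℝ) 1)) (c : ℝ) {a b : ℝ}
    (ha : a ∈ Icc (0:ℝ) 1) (hb : b ∈ Icc (0:ℝ) 1) :
    prim c f b = prim c f a + ∫ r in a..b, f r := by
  have h0 : (0:ℝ) ∈ Icc (0:ℝ) 1 := ⟨le_rfl, zero_le_one⟩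
  have hi : ∀ {x y : ℝ}, x ∈ Icc (0:ℝ) 1 → y ∈ Icc (0:ℝ) 1 → IntervalIntegrable f volume x y := by
    intro x y hx hy
    rw [intervalIntegrable_iff]
    exact hf.mono_set (uIoc_subset_uIcc.trans (uIcc_subset_Icc hx hy))
  have := intervalIntegral.integral_add_adjacent_intervals (hi h0 ha) (hi ha hb)
  simp only [prim]
  linarith

/-- The functional `v ↦ ∫₀ˢ v` on `L²(0,1)`. -/
def intFun (s : ℝ) : L2 →L[ℝ] ℝ :=
  innerSL ℝ (indicatorConstLp 2 (measurableSet_Icc (a := (0:ℝ)) (b := s))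
    (measure_ne_top _ _) (1:ℝ))

theorem intFun_apply {s : ℝ} (hs : s ∈ Icc (0:ℝ) 1) (v : L2) :
    intFun s v = ∫ r in (0:ℝ)..s, v r := by
  rw [intFun, innerSL_apply_apply, L2.inner_indicatorConstLp_one,
    Measure.restrict_restrict measurableSet_Icc,
    inter_eq_left.2 (Icc_subset_Icc_right hs.2), intervalIntegral.integral_of_le hs.1,
    integral_Icc_eq_integral_Ioc]

theorem abs_intFun_le (s : ℝ) (v : L2) : |intFun s v| ≤ ‖v‖ := by
  refine ((intFun s).le_opNorm v).trans ?_
  have : ‖intFun s‖ ≤ 1 := by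
    rw [intFun, innerSL_apply_norm, norm_indicatorConstLp (by norm_num) (by norm_num)]
    simp only [norm_one, one_mul]
    refine Real.rpow_le_one measureReal_nonneg ?_ (by norm_num)
    refine (measureReal_mono (subset_univ _)).trans ?_
    simp [Measure.real]
  calc _ ≤ 1 * ‖v‖ := by gcongr
    _ = _ := one_mul _

theorem prim_eq_intFun (c : ℝ) {s : ℝ} (hs : s ∈ Icc (0:ℝ) 1) (v : L2) :
    prim c v s = c + intFun s v := by rw [prim, intFun_apply hs]

/-- The functional `v ↦ ∫₀ˢ ∫₀ʳ v` on `L²(0,1)`, for `s ∈ [0,1]`. -/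
def intIntFun (s : ℝ) (hs : s ∈ Icc (0:ℝ) 1) : L2 →L[ℝ] ℝ :=
  have hc : ∀ v : L2, IntervalIntegrable (fun r => intFun r v) volume 0 s := fun v => by
    have : ContinuousOn (fun r => intFun r v) (Icc (0:ℝ) 1) :=
      (continuousOn_prim (integrableOn_coe v) 0).congr fun r hr => by
        rw [prim_eq_intFun 0 hr, zero_add]
    refine (this.mono ?_).intervalIntegrable
    rw [uIcc_of_le hs.1]
    exact Icc_subset_Icc_right hs.2
  LinearMap.mkContinuous
    { toFun := fun v => ∫ r in (0:ℝ)..s, intFun r v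
      map_add' := fun v w => by
        simp only [map_add]
        exact intervalIntegral.integral_add (hc v) (hc w)
      map_smul' := fun c v => by
        simp } 1 fun v => by
    have := intervalIntegral.norm_integral_le_of_norm_le_const (a := 0) (b := s)
      (f := fun r => intFun r v) (C := ‖v‖) fun x _ => abs_intFun_le x v
    rw [sub_zero, abs_of_nonneg hs.1] at this
    refine this.trans ?_
    rw [mul_comm]
    exact mul_le_mul_of_nonneg_right hs.2 (norm_nonneg _)

theorem prim_prim_eq (c d : ℝ) {s : ℝ} (hs : s ∈ Icc (0:ℝ) 1) (v : L2) :
    prim d (prim c v) s = d + (c * s + intIntFun s hs v) := by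
  have h : ∫ r in (0:ℝ)..s, prim c v r = ∫ r in (0:ℝ)..s, (c + intFun r v) := by
    refine intervalIntegral.integral_congr fun r hr => ?_
    rw [uIcc_of_le hs.1] at hr
    exact prim_eq_intFun c ⟨hr.1, hr.2.trans hs.2⟩ v
  have hc : IntervalIntegrable (fun r => intFun r v) volume 0 s := by
    have : ContinuousOn (fun r => intFun r v) (Icc (0:ℝ) 1) :=
      (continuousOn_prim (integrableOn_coe v) 0).congr fun r hr => by
        rw [prim_eq_intFun 0 hr, zero_add]
    refine (this.mono ?_).intervalIntegrable
    rw [uIcc_of_le hs.1]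
    exact Icc_subset_Icc_right hs.2
  rw [prim, h, intervalIntegral.integral_add (by simp) hc]
  simp [intIntFun, mul_comm]

/-- A curve of constant speed `L` on `[0,1]` whose second derivative `(v,w)` is in `L²` and whose
first derivative starts at `(p,q)`, running from `(0,0)` to `(1,0)` above `ψ` with nonnegative
horizontal velocity. -/
structure ConstSpeed (ψ : ℝ → ℝ) (L p q : ℝ) (v w : L2) : Prop where
  pos : 0 < L
  nonneg : ∀ s ∈ Ioo (0:ℝ) 1, 0 ≤ prim p v s
  speed : ∀ s ∈ Ioo (0:ℝ) 1, prim p v s ^ 2 + prim q w s ^ 2 = L ^ 2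
  x_one : prim 0 (prim p v) 1 = 1
  y_one : prim 0 (prim q w) 1 = 0
  obst : ∀ s ∈ Icc (0:ℝ) 1, ψ (prim 0 (prim p v) s) ≤ prim 0 (prim q w) s

/-- The penalized elastic energy of a curve of constant speed. -/
def csEnergy (ε L : ℝ) (v w : L2) : ℝ := (‖v‖ ^ 2 + ‖w‖ ^ 2) / L ^ 3 + ε * L

namespace ConstSpeed

variable {ψ : ℝ → ℝ} {L p q : ℝ} {v w : L2}

theorem x_mem (h : ConstSpeed ψ L p q v w) {s : ℝ} (hs : s ∈ Icc (0:ℝ) 1) :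
    prim 0 (prim p v) s ∈ Icc (0:ℝ) 1 := by
  have hintg : IntegrableOn (prim p v) (Icc (0:ℝ) 1) :=
    (continuousOn_prim (integrableOn_coe v) p).integrableOn_Icc
  have hnn : ∀ a b : ℝ, 0 ≤ a → a ≤ b → b ≤ 1 → 0 ≤ ∫ r in a..b, prim p v r := by
    intro a b ha hab hb
    rw [intervalIntegral.integral_of_le hab, integral_Ioc_eq_integral_Ioo]
    refine setIntegral_nonneg measurableSet_Ioo fun r hr => h.nonneg r ⟨?_, ?_⟩
    · exact ha.trans_lt hr.1
    · exact hr.2.trans_le hb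
  constructor
  · simpa [prim] using hnn 0 s le_rfl hs.1 hs.2
  · have h1 := prim_sub hintg 0 hs (b := 1) ⟨zero_le_one, le_rfl⟩
    rw [h.x_one] at h1
    linarith [hnn s 1 hs.1 hs.2 le_rfl]

theorem one_le (h : ConstSpeed ψ L p q v w) : 1 ≤ L := by
  have hintg : IntegrableOn (prim p v) (Icc (0:ℝ) 1) :=
    (continuousOn_prim (integrableOn_coe v) p).integrableOn_Icc
  have h1 := h.x_one
  rw [prim, zero_add, intervalIntegral.integral_of_le zero_le_one,
    integral_Ioc_eq_integral_Ioo] at h1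
  rw [← h1]
  calc ∫ r in Ioo (0:ℝ) 1, prim p v r ≤ ∫ r in Ioo (0:ℝ) 1, L := by
        refine setIntegral_mono_on (hintg.mono_set Ioo_subset_Icc_self) (by simp)
          measurableSet_Ioo fun r hr => ?_
        exact (abs_le.1 (abs_le_of_sq_le_sq (by nlinarith [h.speed r hr, sq_nonneg (prim q w r)])
          h.pos.le)).2
    _ = L := by simp

theorem abs_init_le (h : ConstSpeed ψ L p q v w) : |p| ≤ L + ‖v‖ ∧ |q| ≤ L + ‖w‖ := by
  have hm : (1/2:ℝ) ∈ Ioo (0:ℝ) 1 := by constructor <;> norm_num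
  have hs := h.speed _ hm
  rw [prim_eq_intFun _ (Ioo_subset_Icc_self hm), prim_eq_intFun _ (Ioo_subset_Icc_self hm)] at hs
  have h1 :=
    abs_le.1 (abs_le_of_sq_le_sq (a := p + intFun (1/2) v) (b := L) (by nlinarith) h.pos.le)
  have h2 :=
    abs_le.1 (abs_le_of_sq_le_sq (a := q + intFun (1/2) w) (b := L) (by nlinarith) h.pos.le)
  have h3 := abs_le.1 (abs_intFun_le (1/2) v)
  have h4 := abs_le.1 (abs_intFun_le (1/2) w)
  constructor <;> refine abs_le.2 ⟨?_, ?_⟩ <;> linarith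

end ConstSpeed

/-- A sequence of curves of constant speed of bounded energy has a limit, along which the energy is
lower semicontinuous. -/
theorem exists_constSpeed_limit {ψ : ℝ → ℝ} (hψ : ContinuousOn ψ (Icc 0 1)) {ε : ℝ} (hε : 0 < ε)
    {L p q : ℕ → ℝ} {v w : ℕ → L2} {C m : ℝ}
    (h : ∀ n, ConstSpeed ψ (L n) (p n) (q n) (v n) (w n))
    (hC : ∀ n, csEnergy ε (L n) (v n) (w n) ≤ C)
    {e : ℕ → ℝ} (he : ∀ n, csEnergy ε (L n) (v n) (w n) ≤ e n) (hm : Tendsto e atTop (𝓝 m)) :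
    ∃ L p q v w, ConstSpeed ψ L p q v w ∧ csEnergy ε L v w ≤ m := by
  let U : Ultrafilter ℕ := hyperfilter ℕ
  have hU : (U : Filter ℕ) ≤ atTop := by
    rw [← Nat.cofinite_eq_atTop]; exact hyperfilter_le_cofinite
  have hL1 : ∀ n, 1 ≤ L n := fun n => (h n).one_le
  have hLpos : ∀ n, 0 < L n := fun n => (h n).pos
  have hquot : ∀ n, 0 ≤ (‖v n‖ ^ 2 + ‖w n‖ ^ 2) / L n ^ 3 := fun n => by
    have := hLpos n; positivity
  have hLC : ∀ n, L n ≤ C / ε := fun n => by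
    rw [le_div_iff₀ hε]
    have := hC n
    simp only [csEnergy] at this
    linarith [hquot n]
  have hnorm : ∀ n, ‖v n‖ ^ 2 + ‖w n‖ ^ 2 ≤ C * (C / ε) ^ 3 := fun n => by
    have h1 : (‖v n‖ ^ 2 + ‖w n‖ ^ 2) / L n ^ 3 ≤ C := by
      have := hC n
      simp only [csEnergy] at this
      nlinarith [hLpos n]
    have hC0 : 0 ≤ C := (hquot n).trans h1
    rw [div_le_iff₀ (pow_pos (hLpos n) 3)] at h1
    refine h1.trans ?_
    gcongr
    exacts [(hLpos n).le, hLC n]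
  set B := Real.sqrt (C * (C / ε) ^ 3) with hB
  have hvB : ∀ n, ‖v n‖ ≤ B := fun n =>
    Real.le_sqrt_of_sq_le (by nlinarith [hnorm n, sq_nonneg ‖w n‖])
  have hwB : ∀ n, ‖w n‖ ≤ B := fun n =>
    Real.le_sqrt_of_sq_le (by nlinarith [hnorm n, sq_nonneg ‖v n‖])
  obtain ⟨L', -, hL'⟩ := U.exists_tendsto_of_abs_le (f := L) (C := C / ε) fun n => by
    rw [abs_of_pos (hLpos n)]; exact hLC n
  obtain ⟨p', -, hp'⟩ := U.exists_tendsto_of_abs_le (f := p) (C := C / ε + B) fun n =>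
    (h n).abs_init_le.1.trans (add_le_add (hLC n) (hvB n))
  obtain ⟨q', -, hq'⟩ := U.exists_tendsto_of_abs_le (f := q) (C := C / ε + B) fun n =>
    (h n).abs_init_le.2.trans (add_le_add (hLC n) (hwB n))
  obtain ⟨v', hv'⟩ := exists_weak_limit U v B hvB
  obtain ⟨w', hw'⟩ := exists_weak_limit U w B hwB
  obtain ⟨Av, -, hAv⟩ := U.exists_tendsto_of_abs_le (f := fun n => ‖v n‖ ^ 2) (C := B ^ 2)
    fun n => by
    rw [abs_of_nonneg (sq_nonneg _)]; gcongr; exact hvB n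
  obtain ⟨Aw, -, hAw⟩ := U.exists_tendsto_of_abs_le (f := fun n => ‖w n‖ ^ 2) (C := B ^ 2)
    fun n => by
    rw [abs_of_nonneg (sq_nonneg _)]; gcongr; exact hwB n
  have hL'1 : 1 ≤ L' := ge_of_tendsto' hL' hL1
  have hP : ∀ s ∈ Icc (0:ℝ) 1, Tendsto (fun n => prim (p n) (v n) s) U (𝓝 (prim p' v' s)) := by
    intro s hs
    simp only [prim_eq_intFun _ hs]
    exact hp'.add (hv' _)
  have hQ : ∀ s ∈ Icc (0:ℝ) 1, Tendsto (fun n => prim (q n) (w n) s) U (𝓝 (prim q' w' s)) := by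
    intro s hs
    simp only [prim_eq_intFun _ hs]
    exact hq'.add (hw' _)
  have hX : ∀ s ∈ Icc (0:ℝ) 1, Tendsto (fun n => prim 0 (prim (p n) (v n)) s) U
      (𝓝 (prim 0 (prim p' v') s)) := by
    intro s hs
    simp only [prim_prim_eq _ _ hs]
    exact ((hp'.mul_const s).add (hv' _)).const_add 0
  have hY : ∀ s ∈ Icc (0:ℝ) 1, Tendsto (fun n => prim 0 (prim (q n) (w n)) s) U
      (𝓝 (prim 0 (prim q' w') s)) := by
    intro s hs
    simp only [prim_prim_eq _ _ hs]
    exact ((hq'.mul_const s).add (hw' _)).const_add 0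
  have h1 : (1:ℝ) ∈ Icc (0:ℝ) 1 := ⟨zero_le_one, le_rfl⟩
  refine ⟨L', p', q', v', w',
    ⟨by linarith, fun s hs => ?_, fun s hs => ?_, ?_, ?_, fun s hs => ?_⟩, ?_⟩
  · exact ge_of_tendsto' (hP s (Ioo_subset_Icc_self hs)) fun n => (h n).nonneg s hs
  · have ht := ((hP s (Ioo_subset_Icc_self hs)).pow 2).add ((hQ s (Ioo_subset_Icc_self hs)).pow 2)
    refine tendsto_nhds_unique ht ?_
    simp only [(h _).speed s hs]
    exact hL'.pow 2
  · refine tendsto_nhds_unique (hX 1 h1) ?_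
    simp only [(h _).x_one]
    exact tendsto_const_nhds
  · refine tendsto_nhds_unique (hY 1 h1) ?_
    simp only [(h _).y_one]
    exact tendsto_const_nhds
  · have hmem : prim 0 (prim p' v') s ∈ Icc (0:ℝ) 1 :=
      isClosed_Icc.mem_of_tendsto (hX s hs) (Eventually.of_forall fun n => (h n).x_mem hs)
    have ht := (hψ _ hmem).tendsto.comp (tendsto_nhdsWithin_iff.2
      ⟨hX s hs, Eventually.of_forall fun n => (h n).x_mem hs⟩)
    exact le_of_tendsto_of_tendsto' ht (hY s hs) fun n => (h n).obst s hs
  · have ht : Tendsto (fun n => csEnergy ε (L n) (v n) (w n)) U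
        (𝓝 ((Av + Aw) / L' ^ 3 + ε * L')) :=
      ((hAv.add hAw).div (hL'.pow 3) (by positivity)).add (hL'.const_mul ε)
    refine le_trans ?_ (le_of_tendsto_of_tendsto' ht (hm.mono_left hU) he)
    have h1 := norm_sq_le_of_weak_limit hv' hAv
    have h2 := norm_sq_le_of_weak_limit hw' hAw
    rw [csEnergy]
    gcongr

theorem isPrim_prim (c : ℝ) (v : L2) {a b : ℝ} (ha : a ∈ Icc (0:ℝ) 1) (hb : b ∈ Icc (0:ℝ) 1) :
    IsPrim (prim c v) v a b :=
  isPrim_of_integral (intervalIntegrable_coe v ha hb) fun _ hx =>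
    prim_sub (integrableOn_coe v) c ha (uIcc_subset_Icc ha hb hx)

theorem hasDerivAt_prim {f : ℝ → ℝ} (hf : IntegrableOn f (Icc (0:ℝ) 1))
    (hc : ContinuousOn f (Ioo (0:ℝ) 1)) (c : ℝ) {t : ℝ} (ht : t ∈ Ioo (0:ℝ) 1) :
    HasDerivAt (prim c f) (f t) t := by
  refine (intervalIntegral.integral_hasDerivAt_right ?_ ?_ ?_).const_add c
  · rw [intervalIntegrable_iff, uIoc_of_le ht.1.le]
    exact hf.mono_set (Ioc_subset_Icc_self.trans (Icc_subset_Icc_right ht.2.le))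
  · exact hc.stronglyMeasurableAtFilter isOpen_Ioo t ht
  · exact hc.continuousAt (isOpen_Ioo.mem_nhds ht)

/-- Where the horizontal velocity is positive, a curve with second derivative in `L²` is a graph of
class `W^{2,2}_loc`. -/
theorem exists_graph_prim (p q : ℝ) (v w : L2) {a b : ℝ} (ha : 0 ≤ a) (hab : a < b) (hb : b ≤ 1)
    (hpos : ∀ t ∈ Ioo a b, 0 < prim p v t) :
    ∃ u du ddu : ℝ → ℝ, W22locOn u du ddu (prim 0 (prim p v) a) (prim 0 (prim p v) b) ∧
      ∀ t ∈ Ioo a b, u (prim 0 (prim p v) t) = prim 0 (prim q w) t := by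
  have hsub : Icc a b ⊆ Icc (0:ℝ) 1 := Icc_subset_Icc ha hb
  have hPc := continuousOn_prim (integrableOn_coe v) p
  have hQc := continuousOn_prim (integrableOn_coe w) q
  set P := prim p v with hP
  set Q := prim q w with hQ
  have hXc := continuousOn_prim hPc.integrableOn_Icc 0
  have hXd : ∀ t ∈ Ioo a b, HasDerivAt (prim 0 P) (P t) t := fun t ht =>
    hasDerivAt_prim hPc.integrableOn_Icc (hPc.mono Ioo_subset_Icc_self) 0
      ⟨ha.trans_lt ht.1, ht.2.trans_le hb⟩
  have hYsub : ∀ t₀ ∈ Ioo a b, ∀ t₁ ∈ Ioo a b, prim 0 Q t₁ = prim 0 Q t₀ + ∫ r in t₀..t₁, Q r :=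
    fun t₀ h₀ t₁ h₁ => prim_sub hQc.integrableOn_Icc 0 (hsub (Ioo_subset_Icc_self h₀))
      (hsub (Ioo_subset_Icc_self h₁))
  set X := prim 0 P with hX
  set Y := prim 0 Q with hY
  have hmono : StrictMonoOn X (Icc a b) := by
    refine strictMonoOn_of_deriv_pos (convex_Icc a b) (hXc.mono hsub) ?_
    rw [interior_Icc]
    intro t ht
    rw [(hXd t ht).deriv]
    exact hpos t ht
  have hinj : InjOn X (Ioo a b) := hmono.injOn.mono Ioo_subset_Icc_self
  have hsurj : ∀ s ∈ Ioo (X a) (X b), ∃ t ∈ Ioo a b, X t = s :=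
    intermediate_value_Ioo hab.le (hXc.mono hsub)
  have hle : ∀ t₀ ∈ Ioo a b, ∀ t₁ ∈ Ioo a b, X t₀ ≤ X t₁ → t₀ ≤ t₁ := fun t₀ h₀ t₁ h₁ h =>
    (hmono.le_iff_le (Ioo_subset_Icc_self h₀) (Ioo_subset_Icc_self h₁)).1 h
  set g := Function.invFunOn X (Ioo a b) with hg
  have hgX : ∀ t ∈ Ioo a b, g (X t) = t := hinj.leftInvOn_invFunOn
  have hIcc : ∀ t₀ ∈ Ioo a b, ∀ t₁ ∈ Ioo a b, Icc t₀ t₁ ⊆ Ioo a b := fun t₀ h₀ t₁ h₁ t ht =>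
    ⟨h₀.1.trans_le ht.1, ht.2.trans_lt h₁.2⟩
  have hIoo : ∀ t ∈ Ioo a b, t ∈ Icc (0:ℝ) 1 := fun t ht => hsub (Ioo_subset_Icc_self ht)
  have hintg : ∀ h : ℝ → ℝ, ∀ t₀ ∈ Ioo a b, ∀ t₁ ∈ Ioo a b, t₀ ≤ t₁ →
      IntegrableOn (fun t => P t * h t) (Icc t₀ t₁) →
      IntegrableOn (fun s => h (g s)) (Icc (X t₀) (X t₁)) := by
    intro h t₀ h₀ t₁ h₁ h01 hi
    have hs := hIcc t₀ h₀ t₁ h₁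
    rw [← integrableOn_Icc_deriv_smul_iff_of_deriv_nonneg (f' := P)
      (hXc.mono fun t ht => hIoo t (hs ht))
      (fun t ht => hXd t (hs (Ioo_subset_Icc_self ht)))
      (fun t ht => (hpos t (hs (Ioo_subset_Icc_self ht))).le) h01]
    refine hi.congr_fun (fun t ht => ?_) measurableSet_Icc
    simp [hgX t (hs ht)]
  have hval_le : ∀ h : ℝ → ℝ, ∀ t₀ ∈ Ioo a b, ∀ t₁ ∈ Ioo a b, t₀ ≤ t₁ →
      ∫ s in X t₀..X t₁, h (g s) = ∫ t in t₀..t₁, P t * h t := by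
    intro h t₀ h₀ t₁ h₁ h01
    have hs := hIcc t₀ h₀ t₁ h₁
    have hX01 : X t₀ ≤ X t₁ :=
      hmono.monotoneOn (Ioo_subset_Icc_self h₀) (Ioo_subset_Icc_self h₁) h01
    rw [intervalIntegral.integral_of_le h01, intervalIntegral.integral_of_le hX01,
      ← integral_Icc_eq_integral_Ioc, ← integral_Icc_eq_integral_Ioc,
      ← integral_Icc_deriv_smul_of_deriv_nonneg (f' := P)
      (hXc.mono fun t ht => hIoo t (hs ht))
      (fun t ht => hXd t (hs (Ioo_subset_Icc_self ht)))
      (fun t ht => (hpos t (hs (Ioo_subset_Icc_self ht))).le) h01]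
    refine setIntegral_congr_fun measurableSet_Icc fun t ht => ?_
    simp [hgX t (hs ht)]
  have hval : ∀ h : ℝ → ℝ, ∀ t₀ ∈ Ioo a b, ∀ t₁ ∈ Ioo a b,
      ∫ s in X t₀..X t₁, h (g s) = ∫ t in t₀..t₁, P t * h t := by
    intro h t₀ h₀ t₁ h₁
    rcases le_total t₀ t₁ with h01 | h01
    · exact hval_le h t₀ h₀ t₁ h₁ h01
    · rw [intervalIntegral.integral_symm, hval_le h t₁ h₁ t₀ h₀ h01,
        ← intervalIntegral.integral_symm]
  have hloc : ∀ h : ℝ → ℝ, (∀ t₀ ∈ Ioo a b, ∀ t₁ ∈ Ioo a b, t₀ ≤ t₁ →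
      IntegrableOn (fun t => P t * h t) (Icc t₀ t₁)) →
      ∀ c d : ℝ, X a < c → d < X b → IntegrableOn (fun s => h (g s)) (Icc c d) := by
    intro h hi c d hc hd
    rcases lt_or_ge d c with hcd | hcd
    · simp [Icc_eq_empty_of_lt hcd]
    · obtain ⟨t₀, h₀, rfl⟩ := hsurj c ⟨hc, hcd.trans_lt hd⟩
      obtain ⟨t₁, h₁, rfl⟩ := hsurj d ⟨hc.trans_le hcd, hd⟩
      have h01 := hle t₀ h₀ t₁ h₁ hcd
      exact hintg h t₀ h₀ t₁ h₁ h01 (hi t₀ h₀ t₁ h₁ h01)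
  have hPne : ∀ t ∈ Ioo a b, P t ≠ 0 := fun t ht => (hpos t ht).ne'
  have hL2 : ∀ f : ℝ → ℝ, IntegrableOn f (Icc (0:ℝ) 1) → ∀ φ : ℝ → ℝ, ContinuousOn φ (Ioo a b) →
      ∀ t₀ ∈ Ioo a b, ∀ t₁ ∈ Ioo a b, IntegrableOn (fun t => φ t * f t) (Icc t₀ t₁) := by
    intro f hf φ hφ t₀ h₀ t₁ h₁
    have hs := hIcc t₀ h₀ t₁ h₁
    exact (hf.mono_set fun t ht => hIoo t (hs ht)).continuousOn_mul (hφ.mono hs) isCompact_Icc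
  have hPc' : ContinuousOn P (Ioo a b) := hPc.mono hIoo
  have hQc' : ContinuousOn Q (Ioo a b) := hQc.mono hIoo
  have hvv : IntegrableOn (fun t => v t * v t) (Icc (0:ℝ) 1) :=
    (Lp.memLp v).integrable_mul (Lp.memLp v)
  have hvw : IntegrableOn (fun t => v t * w t) (Icc (0:ℝ) 1) :=
    (Lp.memLp v).integrable_mul (Lp.memLp w)
  have hww : IntegrableOn (fun t => w t * w t) (Icc (0:ℝ) 1) :=
    (Lp.memLp w).integrable_mul (Lp.memLp w)
  refine ⟨fun s => Y (g s), fun s => Q (g s) / P (g s),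
    fun s => (w (g s) * P (g s) - Q (g s) * v (g s)) / P (g s) ^ 3,
    ⟨?_, ?_, ?_, ?_, ?_⟩, fun t ht => by simp only [hgX t ht]⟩
  · refine hloc (fun t => Q t / P t) fun t₀ h₀ t₁ h₁ _ => ?_
    refine ContinuousOn.integrableOn_Icc (ContinuousOn.mono ?_ (hIcc t₀ h₀ t₁ h₁))
    exact hPc'.mul (hQc'.div hPc' hPne)
  · refine hloc (fun t => (w t * P t - Q t * v t) / P t ^ 3) fun t₀ h₀ t₁ h₁ _ => ?_
    have h1 := hL2 w (integrableOn_coe w) (fun t => (P t)⁻¹) (hPc'.inv₀ hPne) t₀ h₀ t₁ h₁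
    have h2 := hL2 v (integrableOn_coe v) (fun t => Q t / P t ^ 2)
      (hQc'.div (hPc'.pow 2) fun t ht => pow_ne_zero 2 (hPne t ht)) t₀ h₀ t₁ h₁
    refine (h1.sub h2).congr_fun (fun t ht => ?_) measurableSet_Icc
    have := hPne t (hIcc t₀ h₀ t₁ h₁ ht)
    simp only [Pi.sub_apply]
    field_simp
  · refine hloc (fun t => ((w t * P t - Q t * v t) / P t ^ 3) ^ 2) fun t₀ h₀ t₁ h₁ _ => ?_
    have h1 := hL2 _ hww (fun t => (P t ^ 3)⁻¹)
      ((hPc'.pow 3).inv₀ fun t ht => pow_ne_zero 3 (hPne t ht)) t₀ h₀ t₁ h₁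
    have h2 := hL2 _ hvw (fun t => 2 * Q t / P t ^ 4)
      ((hQc'.const_mul 2).div (hPc'.pow 4) fun t ht => pow_ne_zero 4 (hPne t ht)) t₀ h₀ t₁ h₁
    have h3 := hL2 _ hvv (fun t => Q t ^ 2 / P t ^ 5)
      ((hQc'.pow 2).div (hPc'.pow 5) fun t ht => pow_ne_zero 5 (hPne t ht)) t₀ h₀ t₁ h₁
    refine ((h1.sub h2).add h3).congr_fun (fun t ht => ?_) measurableSet_Icc
    have := hPne t (hIcc t₀ h₀ t₁ h₁ ht)
    simp only [Pi.sub_apply, Pi.add_apply]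
    field_simp
    ring
  · intro s₀ hs₀ s₁ hs₁
    obtain ⟨t₀, h₀, rfl⟩ := hsurj s₀ hs₀
    obtain ⟨t₁, h₁, rfl⟩ := hsurj s₁ hs₁
    rw [hval (fun t => Q t / P t) t₀ h₀ t₁ h₁]
    simp only [hgX t₀ h₀, hgX t₁ h₁]
    rw [hYsub t₀ h₀ t₁ h₁]
    congr 1
    refine intervalIntegral.integral_congr fun t ht => ?_
    have := hPne t (Set.OrdConnected.uIcc_subset ordConnected_Ioo h₀ h₁ ht)
    field_simp
  · intro s₀ hs₀ s₁ hs₁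
    obtain ⟨t₀, h₀, rfl⟩ := hsurj s₀ hs₀
    obtain ⟨t₁, h₁, rfl⟩ := hsurj s₁ hs₁
    rw [hval (fun t => (w t * P t - Q t * v t) / P t ^ 3) t₀ h₀ t₁ h₁]
    simp only [hgX t₀ h₀, hgX t₁ h₁]
    have hu := Set.OrdConnected.uIcc_subset ordConnected_Ioo h₀ h₁
    have hinv := (isPrim_prim p v (hIoo _ h₀) (hIoo _ h₁)).comp (φ := fun y => y⁻¹)
      (φ' := fun y => -(y ^ 2)⁻¹) (fun t ht => hpos t (hu ht))
      (fun y hy => hasDerivAt_inv hy.ne')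
      (((continuousOn_id.pow 2).inv₀ fun y hy => pow_ne_zero 2 (ne_of_gt hy)).neg)
    have hI := ((isPrim_prim q w (hIoo _ h₀) (hIoo _ h₁)).mul hinv).integral_eq
    have he : ∫ t in t₀..t₁, P t * ((w t * P t - Q t * v t) / P t ^ 3) =
        ∫ t in t₀..t₁, (w t * (prim p v t)⁻¹ + prim q w t * (-(prim p v t ^ 2)⁻¹ * v t)) := by
      refine intervalIntegral.integral_congr fun t ht => ?_
      have := hPne t (hu ht)
      simp only [← hP, ← hQ]
      field_simp
      ring
    rw [he, hI]
    simp only [← hP, ← hQ, div_eq_mul_inv]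
    ring

/-- The curve encoded by constant speed data. -/
def csCurve (p q : ℝ) (v w : L2) : Curve where
  x := prim 0 (prim p v)
  y := prim 0 (prim q w)
  dx := prim p v
  dy := prim q w
  dx_int := (continuousOn_prim (integrableOn_coe v) p).integrableOn_Icc
  dy_int := (continuousOn_prim (integrableOn_coe w) q).integrableOn_Icc
  ftc_x := fun t _ => by simp [prim]
  ftc_y := fun t _ => by simp [prim]
  ddx := v
  ddy := w
  ddx_loc := fun _ _ ha hb => (integrableOn_coe v).mono_set (Icc_subset_Icc ha.le hb.le)
  ddy_loc := fun _ _ ha hb => (integrableOn_coe w).mono_set (Icc_subset_Icc ha.le hb.le)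
  ftc_dx := fun _ ha _ ht => prim_sub (integrableOn_coe v) p (Ioo_subset_Icc_self ha)
    (Ioo_subset_Icc_self ht)
  ftc_dy := fun _ ha _ ht => prim_sub (integrableOn_coe w) q (Ioo_subset_Icc_self ha)
    (Ioo_subset_Icc_self ht)

theorem sq_rpow_five_halves {L : ℝ} (hL : 0 ≤ L) : (L ^ 2) ^ ((5:ℝ)/2) = L ^ 5 := by
  rw [← Real.rpow_natCast L 2, ← Real.rpow_mul hL, ← Real.rpow_natCast L 5]
  norm_num

namespace ConstSpeed

variable {ψ : ℝ → ℝ} {L p q : ℝ} {v w : L2}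

theorem speed1_eq (h : ConstSpeed ψ L p q v w) {t : ℝ} (ht : t ∈ Ioo (0:ℝ) 1) :
    speed1 (csCurve p q v w).toCurve1 t = L := by
  have := h.speed t ht
  simp only [speed1, csCurve]
  rw [this, Real.sqrt_sq h.pos.le]

theorem memP (h : ConstSpeed ψ L p q v w) : MemP ψ (csCurve p q v w) := by
  refine ⟨⟨⟨L / 2, half_pos h.pos, fun t ht => ?_⟩, h.nonneg, fun a b ha hab hb hpos =>
    exists_graph_prim p q v w ha hab hb hpos⟩, ?_, ?_, h.x_one, h.y_one, h.obst⟩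
  · rw [h.speed1_eq ht]
    exact half_lt_self h.pos
  · simp [csCurve, prim]
  · simp [csCurve, prim]

theorem penE_le (h : ConstSpeed ψ L p q v w) {ε : ℝ} (hε : 0 ≤ ε) :
    penE ε (csCurve p q v w) ≤ ENNReal.ofReal (csEnergy ε L v w) := by
  have hL := h.pos
  have hlen : lenE (csCurve p q v w) = ENNReal.ofReal L := by
    rw [lenE, len1E, setLIntegral_congr_fun (g := fun _ => ENNReal.ofReal L) measurableSet_Ioo
      fun t ht => by simp only [h.speed1_eq ht]]
    simp
  have hi : IntegrableOn (fun t => (v t ^ 2 + w t ^ 2) / L ^ 3) (Icc (0:ℝ) 1) :=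
    (((Lp.memLp v).integrable_sq).add (Lp.memLp w).integrable_sq).div_const _
  have hel : elE (csCurve p q v w) ≤ ENNReal.ofReal ((‖v‖ ^ 2 + ‖w‖ ^ 2) / L ^ 3) := by
    calc elE (csCurve p q v w)
        ≤ ∫⁻ t in Ioo (0:ℝ) 1, ENNReal.ofReal ((v t ^ 2 + w t ^ 2) / L ^ 3) := by
          refine setLIntegral_mono' measurableSet_Ioo fun t ht => ENNReal.ofReal_le_ofReal ?_
          have hs := h.speed t ht
          simp only [elInt, csCurve]
          rw [hs, sq_rpow_five_halves hL.le, div_le_div_iff₀ (by positivity) (by positivity)]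
          have h1 : (prim p v t * w t - prim q w t * v t) ^ 2 ≤
              L ^ 2 * (v t ^ 2 + w t ^ 2) := by
            rw [← hs]
            nlinarith [sq_nonneg (prim p v t * v t + prim q w t * w t)]
          calc _ ≤ (L ^ 2 * (v t ^ 2 + w t ^ 2)) * L ^ 3 := by gcongr
            _ = _ := by ring
      _ ≤ ∫⁻ t in Icc (0:ℝ) 1, ENNReal.ofReal ((v t ^ 2 + w t ^ 2) / L ^ 3) :=
          lintegral_mono_set Ioo_subset_Icc_self
      _ = ENNReal.ofReal ((‖v‖ ^ 2 + ‖w‖ ^ 2) / L ^ 3) := by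
          rw [← ofReal_integral_eq_lintegral_ofReal hi
            (Eventually.of_forall fun t => by positivity), integral_div, integral_add
            (Lp.memLp v).integrable_sq (Lp.memLp w).integrable_sq, norm_sq_eq_integral,
            norm_sq_eq_integral]
  rw [penE, hlen, csEnergy, ENNReal.ofReal_add (by positivity) (by positivity),
    ENNReal.ofReal_mul hε]
  gcongr

end ConstSpeed

/-- The graph of a parabola, as a curve. -/
def parabola (M : ℝ) : Curve where
  x := fun t => t
  y := fun t => M * t * (1 - t)
  dx := fun _ => 1
  dy := fun t => M * (1 - 2 * t)
  dx_int := by simp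
  dy_int := Continuous.integrableOn_Icc (by fun_prop)
  ftc_x := fun t _ => by simp
  ftc_y := fun t _ => by
    have : ∀ x ∈ uIcc 0 t, HasDerivAt (fun t : ℝ => M * t * (1 - t)) (M * (1 - 2 * x)) x := by
      intro x _
      have := ((hasDerivAt_id x).const_mul M).mul ((hasDerivAt_id x).const_sub 1)
      refine this.congr_deriv ?_
      simp only [id]
      ring
    rw [intervalIntegral.integral_eq_sub_of_hasDerivAt this
      (Continuous.intervalIntegrable (by fun_prop) _ _)]
    ring
  ddx := fun _ => 0
  ddy := fun _ => -2 * M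
  ddx_loc := fun _ _ _ _ => by simp
  ddy_loc := fun _ _ _ _ => continuous_const.integrableOn_Icc
  ftc_dx := fun _ _ _ _ => by simp
  ftc_dy := fun _ _ _ _ => by
    simp only [intervalIntegral.integral_const, smul_eq_mul]
    ring

/-- The class `P_ψ` contains the graph of a sufficiently high parabola. -/
theorem exists_memP {ψ : ℝ → ℝ} (hψ : Admissible ψ) : ∃ γ : Curve, MemP ψ γ := by
  obtain ⟨C, hC⟩ := isCompact_Icc.exists_bound_of_continuousOn hψ.cont
  have h0 : (0:ℝ) ∈ Icc (0:ℝ) 1 := ⟨le_rfl, zero_le_one⟩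
  have h1 : (1:ℝ) ∈ Icc (0:ℝ) 1 := ⟨zero_le_one, le_rfl⟩
  have hC0 : 0 ≤ C := (norm_nonneg _).trans (hC 0 h0)
  obtain ⟨δ₀, hδ₀, hb₀⟩ := Metric.mem_nhdsWithin_iff.1 ((hψ.cont 0 h0).eventually_lt_const hψ.neg0)
  obtain ⟨δ₁, hδ₁, hb₁⟩ := Metric.mem_nhdsWithin_iff.1 ((hψ.cont 1 h1).eventually_lt_const hψ.neg1)
  set δ := min δ₀ δ₁ with hδ
  have hδpos : 0 < δ := lt_min hδ₀ hδ₁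
  set M := C / δ ^ 2 with hM
  have hM0 : 0 ≤ M := by positivity
  refine ⟨parabola M, ⟨⟨1 / 2, by norm_num, fun t _ => ?_⟩, fun t _ => ?_, fun a b _ _ _ _ => ?_⟩,
    rfl, by simp [parabola], rfl, by simp [parabola], fun t ht => ?_⟩
  · rw [speed1]
    refine Real.lt_sqrt_of_sq_lt ?_
    simp only [parabola]
    nlinarith [sq_nonneg (M * (1 - 2 * t))]
  · simp [parabola]
  · refine ⟨(parabola M).y, (parabola M).dy, (parabola M).ddy, ⟨?_, ?_, ?_, ?_, ?_⟩,
      fun t _ => rfl⟩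
    · exact fun _ _ _ _ => Continuous.integrableOn_Icc (by unfold parabola; fun_prop)
    · exact fun _ _ _ _ => continuous_const.integrableOn_Icc
    · exact fun _ _ _ _ => Continuous.integrableOn_Icc (by unfold parabola; fun_prop)
    · intro c _ t _
      have : ∀ x ∈ uIcc c t, HasDerivAt (fun t : ℝ => M * t * (1 - t)) (M * (1 - 2 * x)) x := by
        intro x _
        have := ((hasDerivAt_id x).const_mul M).mul ((hasDerivAt_id x).const_sub 1)
        refine this.congr_deriv ?_
        simp only [id]
        ring
      simp only [parabola]
      rw [intervalIntegral.integral_eq_sub_of_hasDerivAt this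
        (Continuous.intervalIntegrable (by fun_prop) _ _)]
      ring
    · intro _ _ _ _
      simp only [parabola, intervalIntegral.integral_const, smul_eq_mul]
      ring
  · simp only [parabola]
    have hnn : 0 ≤ M * t * (1 - t) := mul_nonneg (mul_nonneg hM0 ht.1) (by linarith [ht.2])
    rcases lt_or_ge t δ with h | h
    · have : ψ t < 0 := hb₀ ⟨by
        rw [Metric.mem_ball, Real.dist_eq, sub_zero, abs_of_nonneg ht.1]
        exact h.trans_le (min_le_left _ _), ht⟩
      linarith
    rcases lt_or_ge (1 - t) δ with h' | h'
    · have : ψ t < 0 := hb₁ ⟨by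
        rw [Metric.mem_ball, Real.dist_eq, abs_sub_comm, abs_of_nonneg (by linarith [ht.2])]
        exact h'.trans_le (min_le_right _ _), ht⟩
      linarith
    · have h2 : δ ^ 2 ≤ t * (1 - t) := by nlinarith
      calc ψ t ≤ C := (abs_le.1 (hC t ht)).2
        _ = M * δ ^ 2 := by rw [hM]; field_simp
        _ ≤ M * (t * (1 - t)) := by gcongr
        _ = M * t * (1 - t) := by ring

/-- One coordinate of the reparametrization of a curve by a multiple `S` of the arclength: `F` is a
coordinate of the unit tangent, `F'` its derivative and `r` the speed. -/
theorem exists_reparam {r S F F' : ℝ → ℝ} {L : ℝ} (hL : 0 < L) (hSc : ContinuousOn S (Icc 0 1))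
    (hSd : ∀ t ∈ Ioo (0:ℝ) 1, HasDerivAt S (r t / L) t) (hr : ∀ t ∈ Ioo (0:ℝ) 1, 0 < r t)
    (hS0 : S 0 = 0) (hS1 : S 1 = 1) (hFi : IntegrableOn F' (Ioo (0:ℝ) 1))
    (hFs : IntegrableOn (fun t => F' t ^ 2 / r t) (Ioo (0:ℝ) 1))
    (hF : ∀ a ∈ Ioo (0:ℝ) 1, ∀ b ∈ Ioo (0:ℝ) 1, ∫ t in a..b, F' t = F b - F a) :
    ∃ (c : ℝ) (V : L2), (∀ t ∈ Ioo (0:ℝ) 1, prim c V (S t) = L * F t) ∧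
      ‖V‖ ^ 2 = L ^ 3 * ∫ t in Ioo (0:ℝ) 1, F' t ^ 2 / r t ∧
      ∀ t ∈ Icc (0:ℝ) 1, prim 0 (prim c V) (S t) = ∫ s in (0:ℝ)..t, r s * F s := by
  have hSpos : ∀ t ∈ Ioo (0:ℝ) 1, 0 < r t / L := fun t ht => div_pos (hr t ht) hL
  have hmono : StrictMonoOn S (Icc 0 1) := by
    refine strictMonoOn_of_deriv_pos (convex_Icc _ _) hSc ?_
    rw [interior_Icc]
    intro t ht
    rw [(hSd t ht).deriv]
    exact hSpos t ht
  have hm0 : (0:ℝ) ∈ Icc (0:ℝ) 1 := ⟨le_rfl, zero_le_one⟩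
  have hm1 : (1:ℝ) ∈ Icc (0:ℝ) 1 := ⟨zero_le_one, le_rfl⟩
  have hSm : ∀ t ∈ Icc (0:ℝ) 1, S t ∈ Icc (0:ℝ) 1 := fun t ht =>
    ⟨hS0 ▸ hmono.monotoneOn hm0 ht ht.1, hS1 ▸ hmono.monotoneOn ht hm1 ht.2⟩
  set g := Function.invFunOn S (Icc 0 1) with hg
  have hgS : ∀ t ∈ Icc (0:ℝ) 1, g (S t) = t := hmono.injOn.leftInvOn_invFunOn
  have hintg : ∀ h : ℝ → ℝ, IntegrableOn (fun t => r t / L * h t) (Ioo 0 1) →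
      IntegrableOn (fun s => h (g s)) (Icc 0 1) := by
    intro h hi
    rw [← hS0, ← hS1, ← integrableOn_Icc_deriv_smul_iff_of_deriv_nonneg
      (f' := fun t => r t / L) hSc hSd (fun t ht => (hSpos t ht).le) zero_le_one,
      integrableOn_Icc_iff_integrableOn_Ioo]
    refine hi.congr_fun (fun t ht => ?_) measurableSet_Ioo
    simp [hgS t (Ioo_subset_Icc_self ht)]
  have hval : ∀ h : ℝ → ℝ, ∀ a ∈ Icc (0:ℝ) 1, ∀ b ∈ Icc (0:ℝ) 1, a ≤ b →
      ∫ s in Icc (S a) (S b), h s = ∫ t in Ioo a b, r t / L * h (S t) := by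
    intro h a ha b hb hab
    have hsub : Icc a b ⊆ Icc (0:ℝ) 1 := Icc_subset_Icc ha.1 hb.2
    have hsub' : Ioo a b ⊆ Ioo (0:ℝ) 1 := Ioo_subset_Ioo ha.1 hb.2
    rw [← integral_Icc_deriv_smul_of_deriv_nonneg (f' := fun t => r t / L) (hSc.mono hsub)
      (fun t ht => hSd t (hsub' ht)) (fun t ht => (hSpos t (hsub' ht)).le) hab,
      integral_Icc_eq_integral_Ioo]
    rfl
  set f : ℝ → ℝ := fun s => L ^ 2 * (F' (g s) / r (g s)) with hf
  have hfi : IntegrableOn f (Icc 0 1) := by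
    refine hintg (fun t => L ^ 2 * (F' t / r t)) ?_
    refine IntegrableOn.congr_fun (f := fun t => L * F' t) (hFi.const_mul L) (fun t ht => ?_)
      measurableSet_Ioo
    have := (hr t ht).ne'
    field_simp
  have hfs : IntegrableOn (fun s => f s ^ 2) (Icc 0 1) := by
    refine hintg (fun t => (L ^ 2 * (F' t / r t)) ^ 2) ?_
    refine IntegrableOn.congr_fun (f := fun t => L ^ 3 * (F' t ^ 2 / r t)) (hFs.const_mul (L ^ 3))
      (fun t ht => ?_) measurableSet_Ioo
    have := (hr t ht).ne'
    field_simp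
  have hfm : MemLp f 2 (volume.restrict (Icc (0:ℝ) 1)) :=
    (memLp_two_iff_integrable_sq hfi.aestronglyMeasurable).2 hfs
  set V : L2 := hfm.toLp f with hV
  have hVf : ∀ᵐ s ∂(volume.restrict (Icc (0:ℝ) 1)), V s = f s := hfm.coeFn_toLp
  have hdiff_le : ∀ a ∈ Ioo (0:ℝ) 1, ∀ b ∈ Ioo (0:ℝ) 1, a ≤ b →
      ∫ s in S a..S b, V s = L * F b - L * F a := by
    intro a ha b hb hab
    have ha' := Ioo_subset_Icc_self ha
    have hb' := Ioo_subset_Icc_self hb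
    rw [intervalIntegral.integral_of_le (hmono.monotoneOn ha' hb' hab),
      ← integral_Icc_eq_integral_Ioc, ← mul_sub, ← hF a ha b hb,
      intervalIntegral.integral_of_le hab, integral_Ioc_eq_integral_Ioo]
    have h1 : ∫ s in Icc (S a) (S b), V s = ∫ s in Icc (S a) (S b), f s :=
      integral_congr_ae (ae_restrict_of_ae_restrict_of_subset
        (Icc_subset_Icc (hSm a ha').1 (hSm b hb').2) hVf)
    rw [h1, hval f a ha' b hb' hab, ← integral_const_mul]
    refine setIntegral_congr_fun measurableSet_Ioo fun t ht => ?_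
    have ht' : t ∈ Ioo (0:ℝ) 1 := ⟨ha.1.trans ht.1, ht.2.trans hb.2⟩
    have := (hr t ht').ne'
    simp only [hf, hgS t (Ioo_subset_Icc_self ht')]
    field_simp
  have hdiff : ∀ a ∈ Ioo (0:ℝ) 1, ∀ b ∈ Ioo (0:ℝ) 1,
      ∫ s in S a..S b, V s = L * F b - L * F a := by
    intro a ha b hb
    rcases le_total a b with hab | hab
    · exact hdiff_le a ha b hb hab
    · rw [intervalIntegral.integral_symm, hdiff_le b hb a ha hab]
      ring
  have hhalf : (1/2:ℝ) ∈ Ioo (0:ℝ) 1 := by constructor <;> norm_num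
  set c := L * F (1/2) - ∫ s in (0:ℝ)..S (1/2), V s with hc
  have hprim : ∀ t ∈ Ioo (0:ℝ) 1, prim c V (S t) = L * F t := by
    intro t ht
    rw [prim_sub (integrableOn_coe V) c (hSm _ (Ioo_subset_Icc_self hhalf))
      (hSm _ (Ioo_subset_Icc_self ht)), hdiff _ hhalf t ht, prim, hc]
    ring
  refine ⟨c, V, hprim, ?_, fun t ht => ?_⟩
  · have h1 : ∫ s in Icc (0:ℝ) 1, V s ^ 2 = ∫ s in Icc (0:ℝ) 1, f s ^ 2 :=
      integral_congr_ae (by filter_upwards [hVf] with s hs; rw [hs])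
    have h2 := hval (fun s => f s ^ 2) 0 hm0 1 hm1 zero_le_one
    rw [hS0, hS1] at h2
    rw [norm_sq_eq_integral, h1, h2, ← integral_const_mul]
    refine setIntegral_congr_fun measurableSet_Ioo fun t ht => ?_
    have := (hr t ht).ne'
    simp only [hf, hgS t (Ioo_subset_Icc_self ht)]
    field_simp
  · have h2 := hval (prim c V) 0 hm0 t ht ht.1
    rw [hS0] at h2
    rw [prim, zero_add, intervalIntegral.integral_of_le (hSm t ht).1,
      ← integral_Icc_eq_integral_Ioc, h2, intervalIntegral.integral_of_le ht.1,
      integral_Ioc_eq_integral_Ioo]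
    refine setIntegral_congr_fun measurableSet_Ioo fun s hs => ?_
    have hs' : s ∈ Ioo (0:ℝ) 1 := ⟨hs.1, hs.2.trans_le ht.2⟩
    simp only [hprim s hs']
    field_simp

theorem exists_Icc_mem_nhds {t : ℝ} (ht : t ∈ Ioo (0:ℝ) 1) :
    ∃ a ∈ Ioo (0:ℝ) 1, ∃ b ∈ Ioo (0:ℝ) 1, a ≤ b ∧ Icc a b ∈ 𝓝 t := by
  obtain ⟨h0, h1⟩ := ht
  refine ⟨t / 2, ⟨by linarith, by linarith⟩, (t + 1) / 2, ⟨by linarith, by linarith⟩, by linarith,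
    Icc_mem_nhds (by linarith) (by linarith)⟩

theorem continuousOn_Ioo_of_isPrim {f f' : ℝ → ℝ}
    (h : ∀ a ∈ Ioo (0:ℝ) 1, ∀ b ∈ Ioo (0:ℝ) 1, IsPrim f f' a b) : ContinuousOn f (Ioo 0 1) := by
  intro t ht
  obtain ⟨a, ha, b, hb, hab, hn⟩ := exists_Icc_mem_nhds ht
  have := (h a ha b hb).1.continuousOn
  rw [uIcc_of_le hab] at this
  exact (this.continuousAt hn).continuousWithinAt

theorem aestronglyMeasurable_of_isPrim {f f' : ℝ → ℝ}
    (h : ∀ a ∈ Ioo (0:ℝ) 1, ∀ b ∈ Ioo (0:ℝ) 1, IsPrim f f' a b) :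
    AEStronglyMeasurable f' (volume.restrict (Ioo (0:ℝ) 1)) := by
  refine LocallyIntegrableOn.aestronglyMeasurable fun t ht => ?_
  obtain ⟨a, ha, b, hb, hab, hn⟩ := exists_Icc_mem_nhds ht
  have := (intervalIntegrable_iff_integrableOn_Icc_of_le hab).1 (h a ha b hb).intervalIntegrable
  exact ⟨Icc a b, mem_nhdsWithin_of_mem_nhds hn, this⟩

/-- The derivative of a coordinate of the unit tangent. -/
theorem integral_deriv_unit_tangent {f g f' g' : ℝ → ℝ} {a b : ℝ} (hf : IsPrim f f' a b)
    (hg : IsPrim g g' a b) (hpos : ∀ x ∈ uIcc a b, 0 < f x ^ 2 + g x ^ 2) :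
    ∫ x in a..b, -(g x * (f x * g' x - g x * f' x)) / √(f x ^ 2 + g x ^ 2) ^ 3 =
      f b / √(f b ^ 2 + g b ^ 2) - f a / √(f a ^ 2 + g a ^ 2) := by
  have hsq := (hf.mul hf).add (hg.mul hg)
  have hinv : ∀ y : ℝ, 0 < y → HasDerivAt (fun y => (√y)⁻¹) (-(1 / (2 * √y)) / √y ^ 2) y :=
    fun y hy => (Real.hasDerivAt_sqrt hy.ne').inv (Real.sqrt_pos.2 hy).ne'
  have hcont : ContinuousOn (fun y : ℝ => -(1 / (2 * √y)) / √y ^ 2) (Ioi 0) := by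
    refine ContinuousOn.div (ContinuousOn.neg (ContinuousOn.div continuousOn_const
      (by fun_prop) fun y hy => ?_)) (by fun_prop) fun y hy => ?_
    · have := Real.sqrt_pos.2 hy
      positivity
    · have := Real.sqrt_pos.2 hy
      positivity
  have h := hf.mul (hsq.comp (φ := fun y => (√y)⁻¹) (fun x hx => by
    simpa only [pow_two] using hpos x hx) hinv hcont)
  have h2 := h.integral_eq
  simp only [← pow_two, ← div_eq_mul_inv] at h2
  rw [← h2]
  refine intervalIntegral.integral_congr fun x hx => ?_
  have hs := Real.sqrt_pos.2 (hpos x hx)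
  have hs2 := Real.sq_sqrt (hpos x hx).le
  set r := √(f x ^ 2 + g x ^ 2)
  field_simp
  rw [hs2]
  ring

/-- Reparametrization of one coordinate `∫ f` of a curve with derivative `(f, g)` by a multiple `S`
of the arclength. -/
theorem exists_reparam_tangent {f g f' g' r S : ℝ → ℝ} {L : ℝ} (hL : 0 < L)
    (hSc : ContinuousOn S (Icc 0 1)) (hSd : ∀ t ∈ Ioo (0:ℝ) 1, HasDerivAt S (r t / L) t)
    (hr : ∀ t ∈ Ioo (0:ℝ) 1, 0 < r t) (hS0 : S 0 = 0) (hS1 : S 1 = 1)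
    (hrdef : ∀ t, r t = √(f t ^ 2 + g t ^ 2)) (hri : IntegrableOn r (Ioo (0:ℝ) 1))
    (hf : ∀ a ∈ Ioo (0:ℝ) 1, ∀ b ∈ Ioo (0:ℝ) 1, IsPrim f f' a b)
    (hg : ∀ a ∈ Ioo (0:ℝ) 1, ∀ b ∈ Ioo (0:ℝ) 1, IsPrim g g' a b)
    (hK : IntegrableOn (fun t => (f t * g' t - g t * f' t) ^ 2 / r t ^ 5) (Ioo (0:ℝ) 1)) :
    ∃ (c : ℝ) (V : L2), (∀ t ∈ Ioo (0:ℝ) 1, prim c V (S t) = L * (f t / r t)) ∧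
      ‖V‖ ^ 2 = L ^ 3 * ∫ t in Ioo (0:ℝ) 1, (g t * (f t * g' t - g t * f' t)) ^ 2 / r t ^ 7 ∧
      IntegrableOn (fun t => (g t * (f t * g' t - g t * f' t)) ^ 2 / r t ^ 7) (Ioo (0:ℝ) 1) ∧
      ∀ t ∈ Icc (0:ℝ) 1, prim 0 (prim c V) (S t) = ∫ s in (0:ℝ)..t, f s := by
  have hr2 : ∀ t, r t ^ 2 = f t ^ 2 + g t ^ 2 := fun t => by
    rw [hrdef, Real.sq_sqrt (by positivity)]
  have hfm := (continuousOn_Ioo_of_isPrim hf).aestronglyMeasurable (μ := volume) measurableSet_Ioo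
  have hgm := (continuousOn_Ioo_of_isPrim hg).aestronglyMeasurable (μ := volume) measurableSet_Ioo
  have hKm := (hfm.mul (aestronglyMeasurable_of_isPrim hg)).sub
    (hgm.mul (aestronglyMeasurable_of_isPrim hf))
  have hrm := hri.aestronglyMeasurable
  have hsq : ∀ t, (-(g t * (f t * g' t - g t * f' t)) / r t ^ 3) ^ 2 / r t =
      (g t * (f t * g' t - g t * f' t)) ^ 2 / r t ^ 7 := fun t => by
    rw [div_pow, neg_sq, div_div]
    ring
  have hle : ∀ t ∈ Ioo (0:ℝ) 1, (g t * (f t * g' t - g t * f' t)) ^ 2 / r t ^ 7 ≤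
      (f t * g' t - g t * f' t) ^ 2 / r t ^ 5 := by
    intro t ht
    have hrt := hr t ht
    rw [div_le_div_iff₀ (by positivity) (by positivity), mul_pow]
    have : g t ^ 2 ≤ r t ^ 2 := by nlinarith [hr2 t, sq_nonneg (f t)]
    calc g t ^ 2 * (f t * g' t - g t * f' t) ^ 2 * r t ^ 5
        ≤ r t ^ 2 * (f t * g' t - g t * f' t) ^ 2 * r t ^ 5 := by gcongr
      _ = _ := by ring
  have hFs : IntegrableOn (fun t => (g t * (f t * g' t - g t * f' t)) ^ 2 / r t ^ 7)
      (Ioo (0:ℝ) 1) := by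
    refine Integrable.mono' hK (((hgm.mul hKm).pow 2).div₀ (hrm.pow 7)) ?_
    filter_upwards [ae_restrict_mem measurableSet_Ioo] with t ht
    rw [Real.norm_of_nonneg (div_nonneg (sq_nonneg _) (pow_nonneg (hr t ht).le _))]
    exact hle t ht
  have hFi : IntegrableOn (fun t => -(g t * (f t * g' t - g t * f' t)) / r t ^ 3)
      (Ioo (0:ℝ) 1) := by
    refine Integrable.mono' (hFs.add hri) ((hgm.mul hKm).neg.div₀ (hrm.pow 3)) ?_
    filter_upwards [ae_restrict_mem measurableSet_Ioo] with t ht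
    have hrt := hr t ht
    rw [Pi.add_apply, ← hsq t, Real.norm_eq_abs]
    set A := -(g t * (f t * g' t - g t * f' t)) / r t ^ 3
    rw [← sq_abs A, div_add' _ _ _ hrt.ne', le_div_iff₀ hrt]
    nlinarith [sq_nonneg (|A| - r t), abs_nonneg A]
  have hF : ∀ a ∈ Ioo (0:ℝ) 1, ∀ b ∈ Ioo (0:ℝ) 1,
      ∫ t in a..b, -(g t * (f t * g' t - g t * f' t)) / r t ^ 3 = f b / r b - f a / r a := by
    intro a ha b hb
    have := integral_deriv_unit_tangent (hf a ha b hb) (hg a ha b hb) fun x hx => by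
      have := hr x ((convex_Ioo (0:ℝ) 1).ordConnected.uIcc_subset ha hb hx)
      rw [← hr2]
      positivity
    simpa only [← hrdef] using this
  obtain ⟨c, V, h1, h2, h3⟩ := exists_reparam (F := fun t => f t / r t) hL hSc hSd hr hS0 hS1 hFi
    (by simpa only [hsq] using hFs) hF
  refine ⟨c, V, h1, by simpa only [hsq] using h2, hFs, fun t ht => ?_⟩
  rw [h3 t ht, intervalIntegral.integral_of_le ht.1, intervalIntegral.integral_of_le ht.1,
    integral_Ioc_eq_integral_Ioo, integral_Ioc_eq_integral_Ioo]
  refine setIntegral_congr_fun measurableSet_Ioo fun s hs => ?_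
  have := (hr s ⟨hs.1, hs.2.trans_le ht.2⟩).ne'
  field_simp

/-- A curve in `P_ψ` of finite energy can be reparametrized to constant speed. -/
theorem exists_constSpeed {ψ : ℝ → ℝ} {τ : Curve} (hτ : MemP ψ τ) {ε : ℝ} (hε : 0 < ε)
    (hfin : penE ε τ ≠ ⊤) :
    ∃ L p q v w, ConstSpeed ψ L p q v w ∧ ENNReal.ofReal (csEnergy ε L v w) ≤ penE ε τ := by
  obtain ⟨⟨⟨δ, hδ, him⟩, hnn, -⟩, hx0, hy0, hx1, hy1, hob⟩ := hτ
  have hx : ∀ a ∈ Ioo (0:ℝ) 1, ∀ b ∈ Ioo (0:ℝ) 1, IsPrim τ.dx τ.ddx a b := fun a ha b hb =>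
    have hsub := (convex_Ioo (0:ℝ) 1).ordConnected.uIcc_subset ha hb
    isPrim_of_integral ((intervalIntegrable_iff' (by simp)).2
      (τ.ddx_loc _ _ (lt_min ha.1 hb.1) (max_lt ha.2 hb.2))) fun t ht => τ.ftc_dx a ha t (hsub ht)
  have hy : ∀ a ∈ Ioo (0:ℝ) 1, ∀ b ∈ Ioo (0:ℝ) 1, IsPrim τ.dy τ.ddy a b := fun a ha b hb =>
    have hsub := (convex_Ioo (0:ℝ) 1).ordConnected.uIcc_subset ha hb
    isPrim_of_integral ((intervalIntegrable_iff' (by simp)).2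
      (τ.ddy_loc _ _ (lt_min ha.1 hb.1) (max_lt ha.2 hb.2))) fun t ht => τ.ftc_dy a ha t (hsub ht)
  have hxc := continuousOn_Ioo_of_isPrim hx
  have hyc := continuousOn_Ioo_of_isPrim hy
  set r : ℝ → ℝ := speed1 τ.toCurve1 with hrdef
  have hr : ∀ t ∈ Ioo (0:ℝ) 1, 0 < r t := fun t ht => hδ.trans (him t ht)
  have hr0 : ∀ t, 0 ≤ r t := fun t => Real.sqrt_nonneg _
  have hrc : ContinuousOn r (Ioo 0 1) := ((hxc.pow 2).add (hyc.pow 2)).sqrt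
  have hr2 : ∀ t, r t ^ 2 = τ.dx t ^ 2 + τ.dy t ^ 2 := fun t => Real.sq_sqrt (by positivity)
  have hri : IntegrableOn r (Ioo (0:ℝ) 1) := by
    have hxi := τ.dx_int.mono_set Ioo_subset_Icc_self
    have hyi := τ.dy_int.mono_set Ioo_subset_Icc_self
    refine Integrable.mono' (hxi.abs.add hyi.abs) (hrc.aestronglyMeasurable measurableSet_Ioo)
      (Eventually.of_forall fun t => ?_)
    rw [Real.norm_of_nonneg (hr0 t)]
    exact Real.sqrt_le_iff.2 ⟨add_nonneg (abs_nonneg _) (abs_nonneg _), by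
      simp only [Pi.add_apply]
      nlinarith [sq_abs (τ.dx t), sq_abs (τ.dy t), abs_nonneg (τ.dx t), abs_nonneg (τ.dy t),
        mul_nonneg (abs_nonneg (τ.dx t)) (abs_nonneg (τ.dy t))]⟩
  set L := ∫ t in Ioo (0:ℝ) 1, r t with hLdef
  have hL : 0 < L := by
    refine hδ.trans_le ?_
    have := setIntegral_mono_on (f := fun _ : ℝ => δ) (by simp) hri measurableSet_Ioo
      fun t ht => (him t ht).le
    simpa using this
  have hlen : lenE τ = ENNReal.ofReal L := by
    rw [lenE, len1E, hLdef, ofReal_integral_eq_lintegral_ofReal hri]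
    exact Eventually.of_forall hr0
  have hel : ∀ t, elInt τ t = (τ.dx t * τ.ddy t - τ.dy t * τ.ddx t) ^ 2 / r t ^ 5 := fun t => by
    rw [elInt, ← hr2, sq_rpow_five_halves (hr0 t)]
  have helnn : ∀ t, 0 ≤ elInt τ t := fun t => by
    rw [hel]
    exact div_nonneg (sq_nonneg _) (pow_nonneg (hr0 t) _)
  have hK : IntegrableOn (elInt τ) (Ioo (0:ℝ) 1) := by
    have hm : AEStronglyMeasurable (elInt τ) (volume.restrict (Ioo (0:ℝ) 1)) := by
      rw [funext hel]
      have hxm := hxc.aestronglyMeasurable (μ := volume) measurableSet_Ioo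
      have hym := hyc.aestronglyMeasurable (μ := volume) measurableSet_Ioo
      exact (((hxm.mul (aestronglyMeasurable_of_isPrim hy)).sub
        (hym.mul (aestronglyMeasurable_of_isPrim hx))).pow 2).div₀ (hri.aestronglyMeasurable.pow 5)
    refine (lintegral_ofReal_ne_top_iff_integrable hm (Eventually.of_forall helnn)).1 ?_
    exact (ENNReal.add_ne_top.1 hfin).1
  have helE : elE τ = ENNReal.ofReal (∫ t in Ioo (0:ℝ) 1, elInt τ t) := by
    rw [elE, ofReal_integral_eq_lintegral_ofReal hK (Eventually.of_forall helnn)]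
  set S := prim 0 (fun t => r t / L) with hS
  have hrLi : IntegrableOn (fun t => r t / L) (Icc (0:ℝ) 1) := by
    rw [integrableOn_Icc_iff_integrableOn_Ioo]
    exact hri.div_const L
  have hSc : ContinuousOn S (Icc 0 1) := continuousOn_prim hrLi 0
  have hSd : ∀ t ∈ Ioo (0:ℝ) 1, HasDerivAt S (r t / L) t := fun t ht =>
    hasDerivAt_prim hrLi (hrc.div_const L) 0 ht
  have hS0 : S 0 = 0 := by simp [hS, prim]
  have hS1 : S 1 = 1 := by
    rw [hS, prim, zero_add, intervalIntegral.integral_of_le zero_le_one,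
      integral_Ioc_eq_integral_Ioo, integral_div, div_self hL.ne']
  obtain ⟨p, v, hP, hv, hvi, hX⟩ := exists_reparam_tangent hL hSc hSd hr hS0 hS1 (fun _ => rfl) hri
    hx hy (by simpa only [funext hel] using hK)
  obtain ⟨q, w, hQ, hw, hwi, hY⟩ := exists_reparam_tangent hL hSc hSd hr hS0 hS1
    (fun t => by rw [hrdef, speed1, add_comm]) hri hy hx (by
      refine hK.congr_fun (fun t _ => ?_) measurableSet_Ioo
      simp only [hel]
      ring)
  have hX' : ∀ t ∈ Icc (0:ℝ) 1, prim 0 (prim p v) (S t) = τ.x t := fun t ht => by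
    rw [hX t ht, τ.ftc_x t ht, hx0, zero_add]
  have hY' : ∀ t ∈ Icc (0:ℝ) 1, prim 0 (prim q w) (S t) = τ.y t := fun t ht => by
    rw [hY t ht, τ.ftc_y t ht, hy0, zero_add]
  have hsurj : ∀ s ∈ Icc (0:ℝ) 1, ∃ t ∈ Icc (0:ℝ) 1, S t = s := fun s hs => by
    have := intermediate_value_Icc zero_le_one hSc
    rw [hS0, hS1] at this
    exact this hs
  have hsurj' : ∀ s ∈ Ioo (0:ℝ) 1, ∃ t ∈ Ioo (0:ℝ) 1, S t = s := fun s hs => by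
    have := intermediate_value_Ioo zero_le_one hSc
    rw [hS0, hS1] at this
    exact this hs
  have hm1 : (1:ℝ) ∈ Icc (0:ℝ) 1 := ⟨zero_le_one, le_rfl⟩
  refine ⟨L, p, q, v, w, ⟨hL, fun s hs => ?_, fun s hs => ?_, ?_, ?_, fun s hs => ?_⟩, ?_⟩
  · obtain ⟨t, ht, rfl⟩ := hsurj' s hs
    rw [hP t ht]
    exact mul_nonneg hL.le (div_nonneg (hnn t ht) (hr t ht).le)
  · obtain ⟨t, ht, rfl⟩ := hsurj' s hs
    rw [hP t ht, hQ t ht, mul_pow, mul_pow, ← mul_add, div_pow, div_pow, ← add_div, ← hr2,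
      div_self (pow_pos (hr t ht) 2).ne', mul_one]
  · have := hX' 1 hm1
    rwa [hS1, hx1] at this
  · have := hY' 1 hm1
    rwa [hS1, hy1] at this
  · obtain ⟨t, ht, rfl⟩ := hsurj s hs
    rw [hX' t ht, hY' t ht]
    exact hob t ht
  · have hsum : ‖v‖ ^ 2 + ‖w‖ ^ 2 = L ^ 3 * ∫ t in Ioo (0:ℝ) 1, elInt τ t := by
      rw [hv, hw, ← mul_add, ← integral_add hvi hwi]
      congr 1
      refine setIntegral_congr_fun measurableSet_Ioo fun t ht => ?_
      have hrt := (hr t ht).ne'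
      simp only [hel]
      rw [← add_div, div_eq_div_iff (pow_ne_zero _ hrt) (pow_ne_zero _ hrt)]
      linear_combination (-(τ.dx t * τ.ddy t - τ.dy t * τ.ddx t) ^ 2 * r t ^ 5) * hr2 t
    rw [csEnergy, hsum, mul_div_cancel_left₀ _ (pow_pos hL 3).ne',
      ENNReal.ofReal_add (integral_nonneg helnn) (mul_nonneg hε.le hL.le),
      ENNReal.ofReal_mul hε.le, penE, helE, hlen]

/-- For every `ε > 0` the penalized energy `E_ε` admits a minimizer in `P_ψ`. -/
theorem stmt7 (ψ : ℝ → ℝ) (hψ : Admissible ψ) (ε : ℝ) (hε : 0 < ε) :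
    ∃ γ : Curve, MemP ψ γ ∧ ∀ τ : Curve, MemP ψ τ → penE ε γ ≤ penE ε τ := by
  obtain ⟨γ₀, hγ₀⟩ := exists_memP hψ
  by_cases hall : ∀ τ, MemP ψ τ → penE ε τ = ⊤
  · exact ⟨γ₀, hγ₀, fun τ hτ => by rw [hall τ hτ]; exact le_top⟩
  push Not at hall
  obtain ⟨τ₀, hτ₀, hfin⟩ := hall
  set A : Set ENNReal := penE ε '' {τ | MemP ψ τ} with hA
  have hA₀ : A.Nonempty := ⟨_, τ₀, hτ₀, rfl⟩
  have hmtop : sInf A ≠ ⊤ := ne_top_of_le_ne_top hfin (sInf_le ⟨τ₀, hτ₀, rfl⟩)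
  obtain ⟨u, hanti, hu, huA⟩ := exists_seq_tendsto_sInf hA₀ (OrderBot.bddBelow A)
  obtain ⟨N, hN⟩ := (hu.eventually_lt_const hmtop.lt_top).exists_forall_of_atTop
  have hne : ∀ n, u (n + N) ≠ ⊤ := fun n => (hN (n + N) (Nat.le_add_left _ _)).ne
  have hu' : Tendsto (fun n => u (n + N)) atTop (𝓝 (sInf A)) := hu.comp (tendsto_add_atTop_nat N)
  choose τ hτ hτu using fun n => huA (n + N)
  choose L p q v w hcs hle using fun n =>
    exists_constSpeed (hτ n) hε (by rw [hτu]; exact hne n)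
  have he : ∀ n, csEnergy ε (L n) (v n) (w n) ≤ (u (n + N)).toReal := fun n =>
    (ENNReal.ofReal_le_iff_le_toReal (hne n)).1 ((hle n).trans_eq (hτu n))
  obtain ⟨L', p', q', v', w', hcs', hle'⟩ := exists_constSpeed_limit hψ.cont hε hcs
    (C := (u (0 + N)).toReal) (fun n => (he n).trans
      (ENNReal.toReal_mono (hne 0) (hanti (Nat.add_le_add_right n.zero_le N))))
    he ((ENNReal.tendsto_toReal hmtop).comp hu')
  refine ⟨_, hcs'.memP, fun σ hσ => ?_⟩
  calc penE ε (csCurve p' q' v' w') ≤ ENNReal.ofReal (csEnergy ε L' v' w') := hcs'.penE_le hε.le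
    _ ≤ ENNReal.ofReal (sInf A).toReal := ENNReal.ofReal_le_ofReal hle'
    _ = sInf A := ENNReal.ofReal_toReal hmtop
    _ ≤ penE ε σ := sInf_le ⟨σ, hσ, rfl⟩
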